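/- Let q be a prime power, K a finite field with q elements, K̄ an algebraic closure of K, and φ the Frobenius map on P¹(K̄) given by [a : b] ↦ [a^q : b^q]. The number of orbits of the componentwise action of PGL₂(K) on the set of ordered 6-tuples (x₁, …, x₆) of pairwise distinct points of P¹(K̄) satisfying φ(x₁) = x₂, φ(x₂) = x₁, φ(x₃) = x₄, φ(x₄) = x₃, φ(x₅) = x₅ and φ(x₆) = x₆ equals q³ − q² − 2q. -/

import Mathlib

open Projectivization

/-! ## The projective line and the actions of `GL₂` and `PGL₂` -/

/-- `GL₂(L)` as a group of linear automorphisms of `L²`. -/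
noncomputable def glMulEquiv (L : Type*) [Field L] :
    GL (Fin 2) L ≃* ((Fin 2 → L) ≃ₗ[L] (Fin 2 → L)) :=
  (Matrix.GeneralLinearGroup.toLin).trans
    (LinearMap.GeneralLinearGroup.generalLinearEquiv L (Fin 2 → L))

theorem glMulEquiv_apply (L : Type*) [Field L] (g : GL (Fin 2) L) (v : Fin 2 → L) :
    glMulEquiv L g v = (g : Matrix (Fin 2) (Fin 2) L).mulVec v := by
  simp [glMulEquiv]

/-- The action of `GL₂(L)` on the projective line `P¹(L)`, given in homogeneous
coordinates by `[a : b] ↦ [α a + β b : γ a + δ b]`. -/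
noncomputable def glP1 (L : Type*) [Field L] :
    GL (Fin 2) L →* Function.End (Projectivization L (Fin 2 → L)) where
  toFun g := Projectivization.map (glMulEquiv L g).toLinearMap (glMulEquiv L g).injective
  map_one' := by
    funext x
    induction x using Projectivization.ind with
    | h v hv =>
      show Projectivization.map (glMulEquiv L 1).toLinearMap (glMulEquiv L 1).injective
          (Projectivization.mk L v hv) = Projectivization.mk L v hv
      rw [Projectivization.map_mk, Projectivization.mk_eq_mk_iff']
      exact ⟨1, by simp [glMulEquiv_apply]⟩
  map_mul' g h := by
    funext x
    induction x using Projectivization.ind with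
    | h v hv =>
      show Projectivization.map (glMulEquiv L (g * h)).toLinearMap
          (glMulEquiv L (g * h)).injective (Projectivization.mk L v hv)
        = Projectivization.map (glMulEquiv L g).toLinearMap (glMulEquiv L g).injective
            (Projectivization.map (glMulEquiv L h).toLinearMap (glMulEquiv L h).injective
              (Projectivization.mk L v hv))
      rw [Projectivization.map_mk, Projectivization.map_mk, Projectivization.map_mk,
        Projectivization.mk_eq_mk_iff']
      exact ⟨1, by simp [glMulEquiv_apply, Matrix.mulVec_mulVec]⟩

/-- The action of `GL₂(L)` on `P¹(L)` as a `MulAction`. -/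
noncomputable instance glP1Action (L : Type*) [Field L] :
    MulAction (GL (Fin 2) L) (Projectivization L (Fin 2 → L)) :=
  MulAction.ofEndHom (glP1 L)

/-- The subgroup of scalar matrices inside `GL₂(L)`. -/
def scalarSubgroup (L : Type*) [Field L] : Subgroup (GL (Fin 2) L) :=
  (Units.map ((Matrix.scalar (Fin 2)) : L →+* Matrix (Fin 2) (Fin 2) L).toMonoidHom).range

instance scalarSubgroup_normal (L : Type*) [Field L] : (scalarSubgroup L).Normal := by
  constructor
  rintro n ⟨a, rfl⟩ g
  refine ⟨a, ?_⟩
  have hc : Commute (Units.map ((Matrix.scalar (Fin 2)) :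
      L →+* Matrix (Fin 2) (Fin 2) L).toMonoidHom a) g := by
    apply Units.ext
    simpa using (Matrix.scalar_commute (a : L) (fun r => mul_comm _ _)
      (g : Matrix (Fin 2) (Fin 2) L)).eq
  rw [← hc.eq, mul_assoc, mul_inv_cancel, mul_one]

/-- `PGL₂(K)`: the quotient of `GL₂(K)` by the subgroup of scalar matrices. -/
abbrev PGL2 (K : Type*) [Field K] := GL (Fin 2) K ⧸ scalarSubgroup K

/-- Scalar matrices act trivially on the projective line. -/
theorem glP1_scalar_eq_one (L : Type*) [Field L] (a : Lˣ) :
    glP1 L (Units.map ((Matrix.scalar (Fin 2)) :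
      L →+* Matrix (Fin 2) (Fin 2) L).toMonoidHom a) = 1 := by
  set u := Units.map ((Matrix.scalar (Fin 2)) :
      L →+* Matrix (Fin 2) (Fin 2) L).toMonoidHom a with hu
  funext x
  induction x using Projectivization.ind with
  | h v hv =>
    show Projectivization.map (glMulEquiv L u).toLinearMap (glMulEquiv L u).injective
        (Projectivization.mk L v hv) = Projectivization.mk L v hv
    rw [Projectivization.map_mk, Projectivization.mk_eq_mk_iff']
    refine ⟨(a : L), ?_⟩
    simp [glMulEquiv_apply, hu, Matrix.scalar_apply, Matrix.diagonal_const_mulVec]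

/-- For a field homomorphism `f : K →+* L`, the scalar matrices of `GL₂(K)` act trivially on
`P¹(L)`, hence the action of `GL₂(K)` on `P¹(L)` descends to an action of `PGL₂(K)`. -/
noncomputable def pglP1 {K L : Type*} [Field K] [Field L] (f : K →+* L) :
    PGL2 K →* Function.End (Projectivization L (Fin 2 → L)) :=
  QuotientGroup.lift (scalarSubgroup K)
    ((glP1 L).comp (Matrix.GeneralLinearGroup.map f))
    (by
      rintro z ⟨a, rfl⟩
      have key : Matrix.GeneralLinearGroup.map (n := Fin 2) f
          (Units.map ((Matrix.scalar (Fin 2)) : K →+* Matrix (Fin 2) (Fin 2) K).toMonoidHom a)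
          = Units.map ((Matrix.scalar (Fin 2)) :
              L →+* Matrix (Fin 2) (Fin 2) L).toMonoidHom (Units.map f.toMonoidHom a) := by
        apply Units.ext
        ext i j
        simp [Matrix.GeneralLinearGroup.map, Matrix.scalar_apply, Matrix.diagonal,
          Matrix.map_apply, apply_ite f]
      rw [MonoidHom.mem_ker, MonoidHom.comp_apply, key, glP1_scalar_eq_one])

/-- The action of `PGL₂(K)` on `P¹(L)`, for any extension `L` of `K` via `f : K →+* L`. -/
noncomputable def pglP1Action {K L : Type*} [Field K] [Field L] (f : K →+* L) :
    MulAction (PGL2 K) (Projectivization L (Fin 2 → L)) :=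
  MulAction.ofEndHom (pglP1 f)
/-- The Frobenius map on the projective line `P¹(L)`, acting in homogeneous coordinates by
`[a : b] ↦ [a ^ q : b ^ q]`. -/
noncomputable def frobP1 {L : Type*} [Field L] (q : ℕ)
    (x : Projectivization L (Fin 2 → L)) : Projectivization L (Fin 2 → L) :=
  Projectivization.mk L (fun i => (x.rep i) ^ q) (by
    intro hzero
    obtain ⟨i, hi⟩ := Function.ne_iff.mp x.rep_nonzero
    have h2 : x.rep i ^ q = 0 := congrFun hzero i
    exact hi (by simpa using (pow_eq_zero_iff'.mp h2).1))

noncomputable instance pglP1ClosureAction (K : Type*) [Field K] :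
    MulAction (PGL2 K)
      (Projectivization (AlgebraicClosure K) (Fin 2 → AlgebraicClosure K)) :=
  pglP1Action (algebraMap K (AlgebraicClosure K))

section FrobeniusFixed

variable (K : Type*) [Field K] [Fintype K] (L : Type*) [Field L]

open Classical in
/-- The elements of `L` fixed by the `n`-th power of the Frobenius of the finite field `K`. -/
noncomputable def frobFixed (n : ℕ) : Finset L :=
  (Polynomial.X ^ Fintype.card K ^ n - Polynomial.X : Polynomial L).roots.toFinset

variable {K L}

theorem mem_frobFixed {n : ℕ} (hn : n ≠ 0) {a : L} :
    a ∈ frobFixed K L n ↔ a ^ Fintype.card K ^ n = a := by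
  have h := FiniteField.X_pow_card_pow_sub_X_ne_zero L hn (Fintype.one_lt_card (α := K))
  simp [frobFixed, Polynomial.mem_roots h, sub_eq_zero]

variable (K L) [Algebra K L] [IsAlgClosed L]

theorem card_frobFixed {n : ℕ} (hn : n ≠ 0) :
    (frobFixed K L n).card = Fintype.card K ^ n := by
  classical
  obtain ⟨p, hp⟩ := CharP.exists K
  have : CharP L p := charP_of_injective_algebraMap (algebraMap K L).injective p
  have hsep : (Polynomial.X ^ Fintype.card K ^ n - Polynomial.X : Polynomial L).Separable :=
    galois_poly_separable p _ (dvd_pow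
      ((CharP.cast_eq_zero_iff K p _).mp (FiniteField.cast_card_eq_zero K)) hn)
  rw [frobFixed, Multiset.toFinset_card_of_nodup (Polynomial.nodup_roots hsep),
    ← (IsAlgClosed.splits _).natDegree_eq_card_roots,
    FiniteField.X_pow_card_pow_sub_X_natDegree_eq L hn Fintype.one_lt_card]

variable {L}

theorem exists_algebraMap_eq_of_pow_card_eq {a : L} (ha : a ^ Fintype.card K = a) :
    ∃ k : K, algebraMap K L k = a := by
  classical
  have hsub : Finset.univ.image (algebraMap K L) ⊆ frobFixed K L 1 := by
    intro b hb
    obtain ⟨k, -, rfl⟩ := Finset.mem_image.mp hb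
    rw [mem_frobFixed one_ne_zero, pow_one, ← map_pow, FiniteField.pow_card]
  have heq := Finset.eq_of_subset_of_card_le hsub (by
    rw [card_frobFixed K L one_ne_zero, pow_one,
      Finset.card_image_of_injective _ (algebraMap K L).injective, Finset.card_univ])
  have : a ∈ frobFixed K L 1 := by rwa [mem_frobFixed one_ne_zero, pow_one]
  rw [← heq] at this
  simpa using this

end FrobeniusFixed

section Frobenius

theorem frobP1_mk {L : Type*} [Field L] (q : ℕ) (v : Fin 2 → L) (hv : v ≠ 0)
    (hv' : (fun i => v i ^ q) ≠ 0) :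
    frobP1 q (Projectivization.mk L v hv) = Projectivization.mk L (fun i => v i ^ q) hv' := by
  obtain ⟨c, hc⟩ := exists_smul_eq_mk_rep L v hv
  rw [frobP1, mk_eq_mk_iff']
  refine ⟨(c : L) ^ q, ?_⟩
  funext i
  rw [← hc]
  simp [Units.smul_def, mul_pow]

end Frobenius

section ProjectiveLine

variable {L : Type*} [Field L]

/-- The affine point `[a : 1]` of the projective line. -/
def affinePt (a : L) : Projectivization L (Fin 2 → L) :=
  Projectivization.mk L ![a, 1] (fun h => one_ne_zero (congrFun h 1))

variable (L) in
/-- The point at infinity `[1 : 0]` of the projective line. -/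
def inftyPt : Projectivization L (Fin 2 → L) :=
  Projectivization.mk L ![1, 0] (fun h => one_ne_zero (congrFun h 0))

theorem affinePt_injective : Function.Injective (affinePt (L := L)) := by
  intro a b h
  obtain ⟨c, hc⟩ := (mk_eq_mk_iff' _ _ _ _ _).mp h
  have h0 := congrFun hc 0
  have h1 := congrFun hc 1
  simp at h0 h1
  simp [← h0, h1]

theorem affinePt_ne_inftyPt (a : L) : affinePt a ≠ inftyPt L := by
  intro h
  obtain ⟨c, hc⟩ := (mk_eq_mk_iff' _ _ _ _ _).mp h
  simpa using congrFun hc 1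

theorem mk_eq_affinePt {v : Fin 2 → L} (hv : v ≠ 0) (h1 : v 1 ≠ 0) :
    Projectivization.mk L v hv = affinePt (v 0 / v 1) := by
  rw [affinePt, mk_eq_mk_iff']
  refine ⟨v 1, ?_⟩
  funext i
  fin_cases i <;> simp [mul_div_cancel₀, h1]

theorem mk_eq_inftyPt {v : Fin 2 → L} (hv : v ≠ 0) (h1 : v 1 = 0) :
    Projectivization.mk L v hv = inftyPt L := by
  rw [inftyPt, mk_eq_mk_iff']
  refine ⟨v 0, ?_⟩
  funext i
  fin_cases i <;> simp [h1]

theorem exists_eq_affinePt {x : Projectivization L (Fin 2 → L)} (hx : x ≠ inftyPt L) :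
    ∃ a, x = affinePt a := by
  induction x using Projectivization.ind with
  | h v hv =>
    by_cases h1 : v 1 = 0
    · exact absurd (mk_eq_inftyPt hv h1) hx
    · exact ⟨_, mk_eq_affinePt hv h1⟩

theorem frobP1_affinePt (q : ℕ) (a : L) : frobP1 q (affinePt a) = affinePt (a ^ q) := by
  have h : (fun i => (![a, 1] : Fin 2 → L) i ^ q) = ![a ^ q, 1] := by
    funext i
    fin_cases i <;> simp
  rw [affinePt, frobP1_mk _ _ _ (by rw [h]; exact fun h => one_ne_zero (congrFun h 1))]
  simp only [h, affinePt]

theorem frobP1_inftyPt {q : ℕ} (hq : q ≠ 0) : frobP1 q (inftyPt L) = inftyPt L := by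
  have h : (fun i => (![1, 0] : Fin 2 → L) i ^ q) = ![1, 0] := by
    funext i
    fin_cases i <;> simp [hq]
  rw [inftyPt, frobP1_mk _ _ _ (by rw [h]; exact fun h => one_ne_zero (congrFun h 0))]
  simp only [h]

/-- The 6-tuple with last two entries `∞` and `0`, built from two pairs `a, a ^ q` and
`b, b ^ q` of affine points. -/
def normalTuple (q : ℕ) (a b : L) : Fin 6 → Projectivization L (Fin 2 → L) :=
  ![affinePt a, affinePt (a ^ q), affinePt b, affinePt (b ^ q), inftyPt L, affinePt 0]

/-- Injective 6-tuples on which the `q`-Frobenius acts through the permutation `(0 1)(2 3)`. -/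
def IsFrobTuple (q : ℕ) (x : Fin 6 → Projectivization L (Fin 2 → L)) : Prop :=
  Function.Injective x ∧ frobP1 q (x 0) = x 1 ∧ frobP1 q (x 1) = x 0 ∧
    frobP1 q (x 2) = x 3 ∧ frobP1 q (x 3) = x 2 ∧ frobP1 q (x 4) = x 4 ∧ frobP1 q (x 5) = x 5

theorem isFrobTuple_normalTuple_iff {q : ℕ} (hq : q ≠ 0) (a b : L) :
    IsFrobTuple q (normalTuple q a b) ↔
      (a ^ q ^ 2 = a ∧ a ^ q ≠ a) ∧ (b ^ q ^ 2 = b ∧ b ^ q ≠ b) ∧ b ≠ a ∧ b ≠ a ^ q := by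
  have hsq (c : L) : c ^ q ^ 2 = (c ^ q) ^ q := by rw [← pow_mul, sq]
  constructor
  · rintro ⟨hinj, -, h1, -, h3, -, -⟩
    have h01 := hinj.ne (show (1 : Fin 6) ≠ 0 by decide)
    have h23 := hinj.ne (show (3 : Fin 6) ≠ 2 by decide)
    have h20 := hinj.ne (show (2 : Fin 6) ≠ 0 by decide)
    have h21 := hinj.ne (show (2 : Fin 6) ≠ 1 by decide)
    simp only [normalTuple, Matrix.cons_val, frobP1_affinePt, ne_eq,
      affinePt_injective.eq_iff] at h1 h3 h01 h23 h20 h21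
    exact ⟨⟨(hsq a).trans h1, h01⟩, ⟨(hsq b).trans h3, h23⟩, h20, h21⟩
  · rintro ⟨⟨ha, ha'⟩, ⟨hb, hb'⟩, hab, hab'⟩
    rw [hsq] at ha hb
    have ha0 : a ≠ 0 := by rintro rfl; exact ha' (zero_pow hq)
    have hb0 : b ≠ 0 := by rintro rfl; exact hb' (zero_pow hq)
    have haq := pow_ne_zero q ha0
    have hbq := pow_ne_zero q hb0
    have h1 : b ^ q ≠ a := fun h => hab' (by rw [← h, hb])
    have h2 : b ^ q ≠ a ^ q := fun h => hab (by rw [← hb, h, ha])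
    refine ⟨?_, ?_⟩
    · intro i j hij
      fin_cases i <;> fin_cases j <;>
        simp [normalTuple, affinePt_injective.eq_iff, affinePt_ne_inftyPt,
          (affinePt_ne_inftyPt _).symm] at hij ⊢ <;> grind
    · simp [normalTuple, frobP1_affinePt, frobP1_inftyPt hq, ha, hb, hq]

end ProjectiveLine

section Action

variable {K : Type*} [Field K]

local notation "Ω" => AlgebraicClosure K

theorem map_mulVec_ne_zero (g : GL (Fin 2) K) {v : Fin 2 → Ω} (hv : v ≠ 0) :
    ((g : Matrix (Fin 2) (Fin 2) K).map (algebraMap K Ω)).mulVec v ≠ 0 := by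
  intro h
  apply hv
  apply (glMulEquiv Ω (Matrix.GeneralLinearGroup.map (algebraMap K Ω) g)).injective
  rw [map_zero, glMulEquiv_apply]
  exact h

theorem pgl_smul_mk (g : GL (Fin 2) K) (v : Fin 2 → Ω) (hv : v ≠ 0) :
    (QuotientGroup.mk g : PGL2 K) • Projectivization.mk Ω v hv =
      Projectivization.mk Ω (((g : Matrix (Fin 2) (Fin 2) K).map (algebraMap K Ω)).mulVec v)
        (map_mulVec_ne_zero g hv) := by
  let e := glMulEquiv Ω (Matrix.GeneralLinearGroup.map (algebraMap K Ω) g)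
  have h : (QuotientGroup.mk g : PGL2 K) • Projectivization.mk Ω v hv =
      Projectivization.map e.toLinearMap e.injective (Projectivization.mk Ω v hv) := rfl
  rw [h, Projectivization.map_mk, mk_eq_mk_iff']
  refine ⟨1, ?_⟩
  rw [one_smul]
  exact (glMulEquiv_apply Ω (Matrix.GeneralLinearGroup.map (algebraMap K Ω) g) v).symm

theorem frobP1_pgl_smul [Fintype K] (g : PGL2 K) (x : Projectivization Ω (Fin 2 → Ω)) :
    frobP1 (Fintype.card K) (g • x) = g • frobP1 (Fintype.card K) x := by
  induction g using QuotientGroup.induction_on with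
  | H g =>
    induction x using Projectivization.ind with
    | h v hv =>
      have hpow {w : Fin 2 → Ω} (hw : w ≠ 0) : (fun i => w i ^ Fintype.card K) ≠ 0 := by
        contrapose! hw
        funext i
        exact pow_eq_zero_iff Fintype.card_ne_zero |>.mp (congrFun hw i)
      rw [pgl_smul_mk, frobP1_mk _ _ _ (hpow (map_mulVec_ne_zero g hv)),
        frobP1_mk _ _ _ (hpow hv), pgl_smul_mk, mk_eq_mk_iff']
      refine ⟨1, ?_⟩
      rw [one_smul]
      funext i
      have hadd (a b : Ω) : (a + b) ^ Fintype.card K = a ^ Fintype.card K + b ^ Fintype.card K :=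
        map_add (FiniteField.frobeniusAlgHom K Ω) a b
      simp [Matrix.mulVec, dotProduct, Fin.sum_univ_two, hadd, mul_pow, ← map_pow,
        FiniteField.pow_card]

theorem IsFrobTuple.pgl_smul [Fintype K] {x : Fin 6 → Projectivization Ω (Fin 2 → Ω)}
    (hx : IsFrobTuple (Fintype.card K) x) (g : PGL2 K) :
    IsFrobTuple (Fintype.card K) (g • x) := by
  obtain ⟨hinj, h⟩ := hx
  refine ⟨(MulAction.injective g).comp hinj, ?_⟩
  simpa only [Pi.smul_apply, frobP1_pgl_smul, (MulAction.injective g).eq_iff] using h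

theorem exists_rational_rep_of_frobP1_eq [Fintype K] {x : Projectivization Ω (Fin 2 → Ω)}
    (hx : frobP1 (Fintype.card K) x = x) :
    ∃ (v : Fin 2 → K) (hv : (fun i => algebraMap K Ω (v i)) ≠ 0),
      x = Projectivization.mk Ω (fun i => algebraMap K Ω (v i)) hv := by
  by_cases h : x = inftyPt Ω
  · refine ⟨![1, 0], fun h => by simpa using congrFun h 0, ?_⟩
    rw [h, mk_eq_inftyPt _ (by simp)]
  · obtain ⟨a, rfl⟩ := exists_eq_affinePt h
    rw [frobP1_affinePt, affinePt_injective.eq_iff] at hx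
    obtain ⟨k, rfl⟩ := exists_algebraMap_eq_of_pow_card_eq K hx
    refine ⟨![k, 1], fun h => by simpa using congrFun h 1, ?_⟩
    rw [mk_eq_affinePt _ (by simp)]
    simp

/-- `PGL₂(K)` moves any two distinct rational points to `∞` and `0`. -/
theorem exists_pgl_smul_eq_inftyPt_and_affinePt_zero [Fintype K]
    {x y : Projectivization Ω (Fin 2 → Ω)} (hx : frobP1 (Fintype.card K) x = x)
    (hy : frobP1 (Fintype.card K) y = y) (hxy : x ≠ y) :
    ∃ g : PGL2 K, g • x = inftyPt Ω ∧ g • y = affinePt 0 := by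
  obtain ⟨v, hv, rfl⟩ := exists_rational_rep_of_frobP1_eq hx
  obtain ⟨w, hw, rfl⟩ := exists_rational_rep_of_frobP1_eq hy
  have hdet : Matrix.det !![v 0, w 0; v 1, w 1] ≠ 0 := by
    intro h
    rw [Matrix.det_fin_two_of, sub_eq_zero] at h
    have h' := congrArg (algebraMap K Ω) h
    simp only [map_mul] at h'
    apply hxy
    by_cases h1 : v 1 = 0
    · have hv0 : v 0 ≠ 0 := by
        intro h0
        apply hv
        funext i
        fin_cases i <;> simp [h0, h1]
      have hw1 : w 1 = 0 := by simpa [h1, hv0] using h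
      rw [mk_eq_inftyPt hv (by simp [h1]), mk_eq_inftyPt hw (by simp [hw1])]
    · have hw1 : w 1 ≠ 0 := by
        intro h0
        have hw0 : w 0 = 0 := by simpa [h0, h1] using h.symm
        apply hw
        funext i
        fin_cases i <;> simp [h0, hw0]
      rw [mk_eq_affinePt hv (by simpa using h1), mk_eq_affinePt hw (by simpa using hw1),
        affinePt_injective.eq_iff, div_eq_div_iff (by simpa using h1) (by simpa using hw1), h']
  let g : GL (Fin 2) K := Matrix.GeneralLinearGroup.mkOfDetNeZero _ hdet
  refine ⟨(QuotientGroup.mk g : PGL2 K)⁻¹, ?_, ?_⟩ <;> rw [inv_smul_eq_iff]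
  · rw [inftyPt, pgl_smul_mk, mk_eq_mk_iff']
    refine ⟨1, ?_⟩
    funext i
    fin_cases i <;>
      simp [g, Matrix.GeneralLinearGroup.mkOfDetNeZero]
  · rw [affinePt, pgl_smul_mk, mk_eq_mk_iff']
    refine ⟨1, ?_⟩
    funext i
    fin_cases i <;>
      simp [g, Matrix.GeneralLinearGroup.mkOfDetNeZero]

theorem IsFrobTuple.exists_pgl_smul_eq_normalTuple [Fintype K]
    {x : Fin 6 → Projectivization Ω (Fin 2 → Ω)} (hx : IsFrobTuple (Fintype.card K) x) :
    ∃ (g : PGL2 K) (a b : Ω), g • x = normalTuple (Fintype.card K) a b := by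
  obtain ⟨g, h4, h5⟩ := exists_pgl_smul_eq_inftyPt_and_affinePt_zero hx.2.2.2.2.2.1
    hx.2.2.2.2.2.2 (hx.1.ne (by decide))
  obtain ⟨hinj, h01, -, h23, -⟩ := hx.pgl_smul g
  have h04 := hinj.ne (show (0 : Fin 6) ≠ 4 by decide)
  have h24 := hinj.ne (show (2 : Fin 6) ≠ 4 by decide)
  rw [Pi.smul_apply, Pi.smul_apply, h4] at h04 h24
  obtain ⟨a, ha⟩ := exists_eq_affinePt h04
  obtain ⟨b, hb⟩ := exists_eq_affinePt h24
  simp only [Pi.smul_apply, ha, hb, frobP1_affinePt] at h01 h23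
  refine ⟨g, a, b, ?_⟩
  funext i
  fin_cases i <;> simp [normalTuple, ← h01, ← h23, ha, hb, h4, h5]

theorem exists_pgl_smul_normalTuple_iff [Fintype K] (a b a' b' : Ω) :
    (∃ g : PGL2 K, g • normalTuple (Fintype.card K) a b = normalTuple (Fintype.card K) a' b') ↔
      ∃ c : Kˣ, a' = algebraMap K Ω c * a ∧ b' = algebraMap K Ω c * b := by
  constructor
  · rintro ⟨g, hg⟩
    induction g using QuotientGroup.induction_on with
    | H g =>
      have h0 := congrFun hg 0
      have h2 := congrFun hg 2
      have h4 := congrFun hg 4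
      have h5 := congrFun hg 5
      simp only [Pi.smul_apply, normalTuple, Matrix.cons_val] at h0 h2 h4 h5
      have hdet : Matrix.det (g : Matrix (Fin 2) (Fin 2) K) ≠ 0 :=
        ((Matrix.isUnit_iff_isUnit_det _).mp g.isUnit).ne_zero
      have h10 : (g : Matrix (Fin 2) (Fin 2) K) 1 0 = 0 := by
        rw [inftyPt, pgl_smul_mk, mk_eq_mk_iff'] at h4
        obtain ⟨c, hc⟩ := h4
        simpa [Matrix.mulVec, dotProduct] using (congrFun hc 1).symm
      have h01 : (g : Matrix (Fin 2) (Fin 2) K) 0 1 = 0 := by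
        rw [affinePt, pgl_smul_mk, mk_eq_mk_iff'] at h5
        obtain ⟨c, hc⟩ := h5
        simpa [Matrix.mulVec, dotProduct] using (congrFun hc 0).symm
      rw [Matrix.det_fin_two, h10, mul_zero, sub_zero] at hdet
      have h00 := left_ne_zero_of_mul hdet
      have h11 := right_ne_zero_of_mul hdet
      have key {s t : Ω} (h : (QuotientGroup.mk g : PGL2 K) • affinePt s = affinePt t) :
          t = algebraMap K Ω (Units.mk0 _ (div_ne_zero h00 h11) : Kˣ) * s := by
        rw [affinePt, pgl_smul_mk, mk_eq_affinePt, affinePt_injective.eq_iff] at h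
        · rw [← h]
          simp [Matrix.mulVec, dotProduct, Fin.sum_univ_two, h01, h10]
          ring
        · simpa [Matrix.mulVec, dotProduct, Fin.sum_univ_two, h10] using h11
      exact ⟨_, key h0, key h2⟩
  · rintro ⟨c, rfl, rfl⟩
    have hdet : Matrix.det !![(c : K), 0; 0, 1] ≠ 0 := by simp
    let g : GL (Fin 2) K := Matrix.GeneralLinearGroup.mkOfDetNeZero _ hdet
    have key (s : Ω) :
        (QuotientGroup.mk g : PGL2 K) • affinePt s = affinePt (algebraMap K Ω c * s) := by
      rw [affinePt, pgl_smul_mk, affinePt, mk_eq_mk_iff']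
      refine ⟨1, ?_⟩
      funext i
      fin_cases i <;>
        simp [g, Matrix.GeneralLinearGroup.mkOfDetNeZero, Matrix.mulVec, dotProduct,
          Fin.sum_univ_two]
    have hinf : (QuotientGroup.mk g : PGL2 K) • inftyPt Ω = inftyPt Ω := by
      rw [inftyPt, pgl_smul_mk, ← inftyPt]
      exact mk_eq_inftyPt _ (by
        simp [g, Matrix.GeneralLinearGroup.mkOfDetNeZero, Matrix.mulVec, dotProduct,
          Fin.sum_univ_two])
    refine ⟨QuotientGroup.mk g, ?_⟩
    funext i
    fin_cases i <;>
      simp [normalTuple, key, hinf, mul_pow, ← map_pow, FiniteField.pow_card]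

end Action

section Counting

variable (K : Type*) [Field K] [Fintype K]

local notation "Ω" => AlgebraicClosure K

/-- The parameters `(a, b)` for which `normalTuple` satisfies the Frobenius conditions. -/
abbrev NormalParam : Type _ :=
  {p : (_ : Ω) × Ω // IsFrobTuple (Fintype.card K) (normalTuple (Fintype.card K) p.1 p.2)}

theorem card_normalParam :
    (Nat.card (NormalParam K) : ℤ) =
      ((Fintype.card K : ℤ) ^ 2 - Fintype.card K) *
        ((Fintype.card K : ℤ) ^ 2 - Fintype.card K - 2) := by
  classical
  set q := Fintype.card K with hq
  have hq0 : q ≠ 0 := Fintype.card_ne_zero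
  let A : Finset Ω := frobFixed K Ω 2 \ frobFixed K Ω 1
  have hA (a : Ω) : a ∈ A ↔ a ^ q ^ 2 = a ∧ a ^ q ≠ a := by
    rw [Finset.mem_sdiff, mem_frobFixed two_ne_zero, mem_frobFixed one_ne_zero, pow_one]
  have hsub : frobFixed K Ω 1 ⊆ frobFixed K Ω 2 := by
    intro a
    rw [mem_frobFixed two_ne_zero, mem_frobFixed one_ne_zero, pow_one, sq, pow_mul]
    intro h
    rw [h, h]
  have hcard : (A.card : ℤ) = (q : ℤ) ^ 2 - q := by
    rw [Finset.cast_card_sdiff hsub, card_frobFixed K Ω two_ne_zero,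
      card_frobFixed K Ω one_ne_zero]
    simp [hq]
  let S : Finset ((_ : Ω) × Ω) := A.sigma fun a => A \ {a, a ^ q}
  have hS (p : (_ : Ω) × Ω) : IsFrobTuple q (normalTuple q p.1 p.2) ↔ p ∈ S := by
    rw [isFrobTuple_normalTuple_iff hq0]
    simp [S, hA, not_or]
  have hScard : (S.card : ℤ) = ((q : ℤ) ^ 2 - q) * ((q : ℤ) ^ 2 - q - 2) := by
    rw [Finset.card_sigma, Nat.cast_sum, ← hcard, ← nsmul_eq_mul]
    apply Finset.sum_eq_card_nsmul
    intro a ha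
    have ha' := (hA a).mp ha
    have haq : a ^ q ∈ A := by
      have : (a ^ q) ^ q = a := by rw [← pow_mul, ← sq, ha'.1]
      rw [hA, sq, pow_mul, this]
      exact ⟨rfl, ha'.2.symm⟩
    rw [Finset.cast_card_sdiff (by simp [Finset.insert_subset_iff, ha, haq]),
      Finset.card_pair ha'.2.symm]
    rfl
  rw [← hScard, Nat.card_congr (Equiv.subtypeEquivRight hS), Nat.card_eq_fintype_card,
    Fintype.card_coe]

/-- The orbit relation of `PGL₂(K)` on the tuples satisfying the Frobenius conditions. -/
noncomputable abbrev frobTupleSetoid :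
    Setoid {x : Fin 6 → Projectivization Ω (Fin 2 → Ω) // IsFrobTuple (Fintype.card K) x} :=
  Setoid.comap Subtype.val (MulAction.orbitRel (PGL2 K) (Fin 6 → Projectivization Ω (Fin 2 → Ω)))

/-- The orbit of the normal tuple with the given parameters. -/
noncomputable def normalOrbit (p : NormalParam K) : Quotient (frobTupleSetoid K) :=
  Quotient.mk _ ⟨normalTuple (Fintype.card K) p.1.1 p.1.2, p.2⟩

variable {K}

theorem normalOrbit_eq_iff (p p' : NormalParam K) :
    normalOrbit K p' = normalOrbit K p ↔
      ∃ c : Kˣ, p'.1.1 = algebraMap K Ω c * p.1.1 ∧ p'.1.2 = algebraMap K Ω c * p.1.2 := by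
  rw [← exists_pgl_smul_normalTuple_iff]
  exact Quotient.eq

theorem normalOrbit_surjective : Function.Surjective (normalOrbit K) := by
  intro y
  induction y using Quotient.inductionOn with
  | h x =>
    obtain ⟨g, a, b, h⟩ := x.2.exists_pgl_smul_eq_normalTuple
    exact ⟨⟨⟨a, b⟩, h ▸ x.2.pgl_smul g⟩, Quotient.sound ⟨g, h⟩⟩

theorem NormalParam.fst_ne_zero (p : NormalParam K) : p.1.1 ≠ 0 := by
  intro h
  apply (((isFrobTuple_normalTuple_iff Fintype.card_ne_zero _ _).mp p.2).1).2
  rw [h, zero_pow Fintype.card_ne_zero]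

/-- The scaling action of `Kˣ` on normal parameters. -/
noncomputable def NormalParam.scale (c : Kˣ) (p : NormalParam K) : NormalParam K :=
  ⟨⟨algebraMap K Ω c * p.1.1, algebraMap K Ω c * p.1.2⟩, by
    obtain ⟨g, hg⟩ := (exists_pgl_smul_normalTuple_iff p.1.1 p.1.2 _ _).mpr ⟨c, rfl, rfl⟩
    exact hg ▸ p.2.pgl_smul g⟩

variable (K)

theorem card_normalParam_eq_card_orbits_mul :
    Nat.card (NormalParam K) =
      Nat.card (Quotient (frobTupleSetoid K)) * (Fintype.card K - 1) := by
  classical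
  let σ := Function.surjInv (normalOrbit_surjective (K := K))
  have hσ (y) : normalOrbit K (σ y) = y := Function.surjInv_eq _ y
  have hbij : Function.Bijective
      fun z : Quotient (frobTupleSetoid K) × Kˣ => NormalParam.scale z.2 (σ z.1) := by
    constructor
    · rintro ⟨y, c⟩ ⟨y', c'⟩ h
      have horb (y : Quotient (frobTupleSetoid K)) (c : Kˣ) :
          normalOrbit K (NormalParam.scale c (σ y)) = y := by
        conv_rhs => rw [← hσ y]
        exact (normalOrbit_eq_iff _ _).mpr ⟨c, rfl, rfl⟩
      obtain rfl : y = y' := by rw [← horb y c, ← horb y' c']; exact congrArg _ h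
      have hfst : algebraMap K Ω c * (σ y).1.1 = algebraMap K Ω c' * (σ y).1.1 :=
        congrArg (fun p : NormalParam K => p.1.1) h
      have hc := (algebraMap K Ω).injective (mul_right_cancel₀ (σ y).fst_ne_zero hfst)
      rw [Units.ext hc]
    · intro p
      obtain ⟨c, h1, h2⟩ := (normalOrbit_eq_iff _ _).mp (hσ (normalOrbit K p)).symm
      refine ⟨⟨normalOrbit K p, c⟩, Subtype.ext (Sigma.ext h1.symm (heq_of_eq h2.symm))⟩
  rw [← Nat.card_congr (Equiv.ofBijective _ hbij), Nat.card_prod,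
    Nat.card_eq_fintype_card (α := Kˣ), Fintype.card_units]

end Counting

/-- the number of `PGL₂(K)`-orbits of injective 6-tuples on `P¹(K̄)`
satisfying the stated Frobenius conditions. -/
theorem statement5 (q : ℕ) (hq : IsPrimePow q)
    (K : Type*) [Field K] [Fintype K] (hK : Fintype.card K = q) :
    (Nat.card (Quotient (Setoid.comap
      (Subtype.val :
        {x : Fin 6 → Projectivization (AlgebraicClosure K) (Fin 2 → AlgebraicClosure K) //
          Function.Injective x ∧
          frobP1 q (x 0) = x 1 ∧
          frobP1 q (x 1) = x 0 ∧
          frobP1 q (x 2) = x 3 ∧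
          frobP1 q (x 3) = x 2 ∧
          frobP1 q (x 4) = x 4 ∧
          frobP1 q (x 5) = x 5} →
        (Fin 6 → Projectivization (AlgebraicClosure K) (Fin 2 → AlgebraicClosure K)))
      (MulAction.orbitRel (PGL2 K)
        (Fin 6 → Projectivization (AlgebraicClosure K) (Fin 2 → AlgebraicClosure K))))) : ℤ)
    = (q : ℤ) ^ 3 - (q : ℤ) ^ 2 - 2 * (q : ℤ) := by
  subst hK
  have hq1 : 1 < Fintype.card K := Fintype.one_lt_card
  have h := card_normalParam K
  rw [card_normalParam_eq_card_orbits_mul, Nat.cast_mul, Nat.cast_sub hq1.le, Nat.cast_one] at h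
  have hq0 : (Fintype.card K : ℤ) - 1 ≠ 0 := by
    have : (1 : ℤ) < Fintype.card K := by exact_mod_cast hq1
    linarith
  apply mul_right_cancel₀ hq0
  refine Eq.trans h ?_
  ring
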